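/- For every integer k ≥ 0, the linear subspace {inc τ : τ ∈ P_k(ℝ³;𝕊)} of P_{k-2}(ℝ³;𝕊) has dimension (1/2)(k+4)(k²−k). -/

import Mathlib

open Matrix

noncomputable section

abbrev V3 : Type := Fin 3 → ℝ
abbrev M3 : Type := Matrix (Fin 3) (Fin 3) ℝ

/-- The Levi-Civita symbol `ε i j k` on `Fin 3`. -/
def eps (i j k : Fin 3) : ℝ :=
  ((((j : ℤ) - (i : ℤ)) * ((k : ℤ) - (j : ℤ)) * ((k : ℤ) - (i : ℤ)) : ℤ) : ℝ) / 2

/-- Partial derivative `∂ᵢ f`. -/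
def pd (i : Fin 3) (f : V3 → ℝ) : V3 → ℝ :=
  fun x => fderiv ℝ f x (Pi.single i 1)

/-- Cross product of vectors in `ℝ³`. -/
def vcross (a b : V3) : V3 := fun i => ∑ k, ∑ l, eps i k l * a k * b l

/-- Symmetric part of a matrix, `sym B = (B + Bᵀ)/2`. -/
def symMat (B : M3) : M3 := (2:ℝ)⁻¹ • (B + Bᵀ)

/-- `(∇v)_{ij} = ∂ᵢ v_j`. -/
def gradv (v : V3 → V3) : V3 → M3 :=
  fun x => Matrix.of fun i j => pd i (fun y => v y j) x

/-- Symmetric gradient (deformation) `def v = (∇v + (∇v)ᵀ)/2`. -/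
def defv (v : V3 → V3) : V3 → M3 := fun x => symMat (gradv v x)

/-- Column-wise curl `(∇×A)_{ij} = Σ_{s,t} ε_{ist} ∂_s A_{tj}`. -/
def colCurl (A : V3 → M3) : V3 → M3 :=
  fun x => Matrix.of fun i j => ∑ s, ∑ t, eps i s t * pd s (fun y => A y t j) x

/-- Row-wise curl `(A×∇)_{ij} = Σ_{k,l} ε_{jkl} ∂_l A_{ik}`. -/
def rowCurl (A : V3 → M3) : V3 → M3 :=
  fun x => Matrix.of fun i j => ∑ k, ∑ l, eps j k l * pd l (fun y => A y i k) x

/-- Incompatibility operator `inc A = ∇×(A×∇)`. -/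
def incOp (A : V3 → M3) : V3 → M3 := colCurl (rowCurl A)

/-- Row-wise divergence `(div A)_i = Σ_j ∂_j A_{ij}`. -/
def divRow (A : V3 → M3) : V3 → V3 :=
  fun x i => ∑ j, pd j (fun y => A y i j) x

/-- Curl of a vector field. -/
def curlVec (w : V3 → V3) : V3 → V3 :=
  fun x i => ∑ s, ∑ t, eps i s t * pd s (fun y => w y t) x

/-- `(b×A)_{ij} = Σ_{k,l} ε_{ikl} b_k A_{lj}`. -/
def bCrossA (b : V3) (A : M3) : M3 :=
  Matrix.of fun i j => ∑ k, ∑ l, eps i k l * b k * A l j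

/-- `(A×b)_{ij} = Σ_{k,l} ε_{jkl} A_{ik} b_l`. -/
def aCrossB (A : M3) (b : V3) : M3 :=
  Matrix.of fun i j => ∑ k, ∑ l, eps j k l * A i k * b l

/-- `f : ℝ³ → ℝ` is a polynomial map of total degree at most `m` (`m : ℤ`, so
`m < 0` forces `f = 0` since the zero polynomial has empty support). -/
def PolyDeg (m : ℤ) (f : V3 → ℝ) : Prop :=
  ∃ p : MvPolynomial (Fin 3) ℝ,
    (∀ d ∈ p.support, ((∑ i, d i : ℕ) : ℤ) ≤ m) ∧ f = fun x => MvPolynomial.eval x p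

/-- `P_m(ℝ³;ℝ³)`. -/
def PolyVec (m : ℤ) (v : V3 → V3) : Prop := ∀ i, PolyDeg m fun x => v x i

/-- `P_m(ℝ³;𝕄)`. -/
def PolyMat (m : ℤ) (A : V3 → M3) : Prop := ∀ i j, PolyDeg m fun x => A x i j

/-- `P_m(ℝ³;𝕊)`: polynomial symmetric-matrix-valued maps of degree at most `m`. -/
def PolySym (m : ℤ) (A : V3 → M3) : Prop := PolyMat m A ∧ ∀ x, (A x)ᵀ = A x


open MvPolynomial

/-- Matrices of real polynomials in three variables. -/
abbrev PMat : Type := Matrix (Fin 3) (Fin 3) (MvPolynomial (Fin 3) ℝ)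

/-- The matrix field defined by a matrix of polynomials. -/
def evalMat : PMat →ₗ[ℝ] (V3 → M3) where
  toFun A x := Matrix.of fun i j => eval x (A i j)
  map_add' A B := by ext; simp
  map_smul' c A := by ext; simp

theorem evalMat_injective : Function.Injective evalMat := by
  intro A B h
  ext1 i j
  exact MvPolynomial.funext fun x => congrFun (congrFun (congrFun h x) i) j

theorem hasFDerivAt_eval (p : MvPolynomial (Fin 3) ℝ) (x : V3) :
    HasFDerivAt (fun y : V3 => eval y p)
      (∑ i, eval x (pderiv i p) • ContinuousLinearMap.proj (R := ℝ) (φ := fun _ => ℝ) i) x := by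
  induction p using MvPolynomial.induction_on with
  | C a => simpa using hasFDerivAt_const a x
  | add p q hp hq =>
    simp only [map_add, add_smul, Finset.sum_add_distrib]
    exact hp.add hq
  | mul_X p n hp =>
    simp only [eval_mul, eval_X]
    refine (hp.mul (hasFDerivAt_apply (𝕜 := ℝ) n x)).congr_fderiv ?_
    ext y
    simp [Derivation.leibniz, Pi.single_apply, add_mul, Finset.sum_add_distrib, Finset.mul_sum,
      apply_ite (eval x), mul_assoc]

theorem pd_eval (i : Fin 3) (p : MvPolynomial (Fin 3) ℝ) :
    pd i (fun y => eval y p) = fun x => eval x (pderiv i p) := by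
  ext x
  simp [pd, (hasFDerivAt_eval p x).fderiv, Pi.single_apply]

/-- Column-wise curl of a matrix of polynomials. -/
def polyColCurl : PMat →ₗ[ℝ] PMat where
  toFun A := Matrix.of fun i j => ∑ s, ∑ t, eps i s t • pderiv s (A t j)
  map_add' A B := by ext1 i j; simp [Finset.sum_add_distrib]
  map_smul' c A := by ext1 i j; simp [Finset.smul_sum, smul_comm c]

/-- Row-wise curl of a matrix of polynomials. -/
def polyRowCurl : PMat →ₗ[ℝ] PMat where
  toFun A := Matrix.of fun i j => ∑ k, ∑ l, eps j k l • pderiv l (A i k)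
  map_add' A B := by ext1 i j; simp [Finset.sum_add_distrib]
  map_smul' c A := by ext1 i j; simp [Finset.smul_sum, smul_comm c]

/-- The incompatibility operator on matrices of polynomials. -/
def polyInc : PMat →ₗ[ℝ] PMat := polyColCurl ∘ₗ polyRowCurl

theorem colCurl_evalMat (A : PMat) : colCurl (evalMat A) = evalMat (polyColCurl A) := by
  ext x i j
  simp [colCurl, evalMat, polyColCurl, pd_eval, smul_eval]

theorem rowCurl_evalMat (A : PMat) : rowCurl (evalMat A) = evalMat (polyRowCurl A) := by
  ext x i j
  simp [rowCurl, evalMat, polyRowCurl, pd_eval, smul_eval]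

theorem incOp_evalMat (A : PMat) : incOp (evalMat A) = evalMat (polyInc A) := by
  rw [incOp, rowCurl_evalMat, colCurl_evalMat]; rfl

/-- Symmetric matrices of polynomials of total degree at most `k`. -/
def polySym (k : ℕ) : Submodule ℝ PMat where
  carrier := {A | (∀ i j d, k < d 0 + d 1 + d 2 → coeff d (A i j) = 0) ∧ ∀ i j, A i j = A j i}
  zero_mem' := by simp
  add_mem' {A B} hA hB := ⟨fun i j d hd => by simp [hA.1 i j d hd, hB.1 i j d hd],
    fun i j => by simp [hA.2 i j, hB.2 i j]⟩
  smul_mem' c A hA := ⟨fun i j d hd => by simp [hA.1 i j d hd], fun i j => by simp [hA.2 i j]⟩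

theorem polySym_iff (k : ℕ) (τ : V3 → M3) :
    PolySym k τ ↔ ∃ A ∈ polySym k, evalMat A = τ := by
  constructor
  · rintro ⟨h, hs⟩
    choose p hp hτ using h
    have hτ' : evalMat p = τ := by
      ext x i j; exact (congrFun (hτ i j) x).symm
    refine ⟨p, ⟨fun i j d hd => ?_, fun i j => ?_⟩, hτ'⟩
    · by_contra hne
      have := hp i j d (mem_support_iff.2 hne)
      rw [Fin.sum_univ_three] at this
      omega
    · refine MvPolynomial.funext fun x => ?_
      have := congrFun (congrFun (hs x) j) i
      rw [← hτ'] at this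
      exact this
  · rintro ⟨A, hA, rfl⟩
    refine ⟨fun i j => ⟨A i j, fun d hd => ?_, rfl⟩, fun x => ?_⟩
    · rw [Fin.sum_univ_three]
      by_contra hlt
      exact mem_support_iff.1 hd (hA.1 i j d (by omega))
    · ext i j
      simp [evalMat, hA.2 i j]

theorem span_inc_eq (k : ℕ) :
    Submodule.span ℝ {f : V3 → M3 | ∃ τ : V3 → M3, PolySym k τ ∧ f = incOp τ}
      = ((polySym k).map polyInc).map evalMat := by
  convert Submodule.span_eq _
  ext f
  simp only [polySym_iff, Set.mem_ofPred_eq, SetLike.mem_coe, Submodule.mem_map]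
  constructor
  · rintro ⟨_, ⟨A, hA, rfl⟩, rfl⟩
    exact ⟨_, ⟨A, hA, rfl⟩, (incOp_evalMat A).symm⟩
  · rintro ⟨_, ⟨A, hA, rfl⟩, rfl⟩
    exact ⟨_, ⟨A, hA, rfl⟩, (incOp_evalMat A).symm⟩

theorem pderiv_comm (i j : Fin 3) (p : MvPolynomial (Fin 3) ℝ) :
    pderiv i (pderiv j p) = pderiv j (pderiv i p) := by
  ext d
  by_cases h : i = j
  · rw [h]
  · simp [coeff_pderiv, add_right_comm, h, Ne.symm h]
    ring

/-- `exps s k` is the set of exponents supported in `s` of total degree at most `k - 2`. -/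
def exps (s : Finset (Fin 3)) (k : ℕ) : Finset (Fin 3 →₀ ℕ) :=
  (Finset.range (k - 1)).biUnion fun n => s.finsuppAntidiag n

theorem mem_exps_univ {k : ℕ} {d : Fin 3 →₀ ℕ} :
    d ∈ exps Finset.univ k ↔ d 0 + d 1 + d 2 + 2 ≤ k := by
  simp [exps, Fin.sum_univ_three]
  omega

theorem mem_exps_pair {k : ℕ} {d : Fin 3 →₀ ℕ} :
    d ∈ exps {0, 1} k ↔ d 0 + d 1 + 2 ≤ k ∧ d 2 = 0 := by
  have : d.support ⊆ {0, 1} ↔ d 2 = 0 := by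
    constructor
    · intro h
      by_contra h2
      simpa using h (Finsupp.mem_support_iff.2 h2)
    · intro h a ha
      fin_cases a <;> simp_all
  simp [exps, this]
  omega

theorem card_exps (s : Finset (Fin 3)) (k : ℕ) :
    (exps s k).card = ∑ n ∈ Finset.range (k - 1), s.card.multichoose n := by
  rw [exps, Finset.card_biUnion]
  · simp [Finset.card_finsuppAntidiag_nat_eq_multichoose]
  · intro m _ n _ hmn
    rw [Function.onFun, Finset.disjoint_left]
    intro d hm hn
    rw [Finset.mem_finsuppAntidiag] at hm hn
    exact hmn (hm.1.symm.trans hn.1)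

theorem card_exps_formula (k : ℕ) :
    3 * (exps Finset.univ k).card + 3 * (exps {0, 1} k).card = (k + 4) * (k ^ 2 - k) / 2 := by
  have h2 (n : ℕ) : Nat.multichoose 2 n = n + 1 := by
    simp [Nat.multichoose_eq, add_comm 2 n, Nat.choose_succ_self_right]
  have h3 (n : ℕ) : 2 * Nat.multichoose 3 n = (n + 1) * (n + 2) := by
    induction n with
    | zero => simp
    | succ n ih => rw [Nat.multichoose_succ_succ, h2, mul_add, ih]; ring
  have hk (m : ℕ) : 2 * (3 * (∑ n ∈ Finset.range m, Nat.multichoose 3 n)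
      + 3 * (∑ n ∈ Finset.range m, Nat.multichoose 2 n)) = (m + 5) * ((m + 1) * m) := by
    induction m with
    | zero => simp
    | succ n ih =>
      rw [Finset.sum_range_succ, Finset.sum_range_succ, h2]
      linear_combination ih + 3 * h3 n
  rw [card_exps, card_exps]
  simp only [Finset.card_univ, Fintype.card_fin, show ({0, 1} : Finset (Fin 3)).card = 2 from rfl]
  cases k with
  | zero => simp
  | succ m =>
    have := hk m
    simp only [Nat.add_sub_cancel, show (m + 1) ^ 2 - (m + 1) = (m + 1) * m by
      rw [Nat.sub_eq_iff_eq_add (by nlinarith)]; ring]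
    rw [show m + 1 + 4 = m + 5 by ring]
    omega

theorem polyInc_eq (A : PMat) : polyInc A =
    !![pderiv 1 (pderiv 2 (A 2 1)) - pderiv 1 (pderiv 1 (A 2 2))
        - pderiv 2 (pderiv 2 (A 1 1)) + pderiv 2 (pderiv 1 (A 1 2)),
      -pderiv 1 (pderiv 2 (A 2 0)) + pderiv 1 (pderiv 0 (A 2 2))
        + pderiv 2 (pderiv 2 (A 1 0)) - pderiv 2 (pderiv 0 (A 1 2)),
      pderiv 1 (pderiv 1 (A 2 0)) - pderiv 1 (pderiv 0 (A 2 1))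
        - pderiv 2 (pderiv 1 (A 1 0)) + pderiv 2 (pderiv 0 (A 1 1));
      -pderiv 0 (pderiv 2 (A 2 1)) + pderiv 0 (pderiv 1 (A 2 2))
        + pderiv 2 (pderiv 2 (A 0 1)) - pderiv 2 (pderiv 1 (A 0 2)),
      pderiv 0 (pderiv 2 (A 2 0)) - pderiv 0 (pderiv 0 (A 2 2))
        - pderiv 2 (pderiv 2 (A 0 0)) + pderiv 2 (pderiv 0 (A 0 2)),
      -pderiv 0 (pderiv 1 (A 2 0)) + pderiv 0 (pderiv 0 (A 2 1))
        + pderiv 2 (pderiv 1 (A 0 0)) - pderiv 2 (pderiv 0 (A 0 1));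
      pderiv 0 (pderiv 2 (A 1 1)) - pderiv 0 (pderiv 1 (A 1 2))
        - pderiv 1 (pderiv 2 (A 0 1)) + pderiv 1 (pderiv 1 (A 0 2)),
      -pderiv 0 (pderiv 2 (A 1 0)) + pderiv 0 (pderiv 0 (A 1 2))
        + pderiv 1 (pderiv 2 (A 0 0)) - pderiv 1 (pderiv 0 (A 0 2)),
      pderiv 0 (pderiv 1 (A 1 0)) - pderiv 0 (pderiv 0 (A 1 1))
        - pderiv 1 (pderiv 1 (A 0 0)) + pderiv 1 (pderiv 0 (A 0 1))] := by
  have h : ((2 : ℝ) - 1) = 1 ∧ (1 - 2 : ℝ) = -1 := by norm_num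
  ext1 i j
  fin_cases i <;> fin_cases j <;>
    simp [polyInc, polyColCurl, polyRowCurl, Fin.sum_univ_three, eps, h.1, h.2] <;> abel

theorem polyInc_symm {A : PMat} (hA : ∀ i j, A i j = A j i) (i j : Fin 3) :
    polyInc A i j = polyInc A j i := by
  rw [polyInc_eq, hA 1 0, hA 2 0, hA 2 1]
  have h10 := pderiv_comm 1 0
  have h20 := pderiv_comm 2 0
  have h21 := pderiv_comm 2 1
  fin_cases i <;> fin_cases j <;> simp [h10, h20, h21] <;> abel

theorem div_polyInc {A : PMat} (hA : ∀ i j, A i j = A j i) (i : Fin 3) :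
    pderiv 0 (polyInc A i 0) + pderiv 1 (polyInc A i 1) + pderiv 2 (polyInc A i 2) = 0 := by
  rw [polyInc_eq, hA 1 0, hA 2 0, hA 2 1]
  have h10 := pderiv_comm 1 0
  have h20 := pderiv_comm 2 0
  have h21 := pderiv_comm 2 1
  fin_cases i <;> simp [h10, h20, h21] <;> abel

theorem coeff_pderiv_pderiv_eq_zero {k : ℕ} {p : MvPolynomial (Fin 3) ℝ}
    (hp : ∀ d : Fin 3 →₀ ℕ, k < d 0 + d 1 + d 2 → coeff d p = 0) (a b : Fin 3)
    {d : Fin 3 →₀ ℕ} (hd : k < d 0 + d 1 + d 2 + 2) : coeff d (pderiv a (pderiv b p)) = 0 := by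
  rw [coeff_pderiv, coeff_pderiv, hp, zero_mul, zero_mul]
  fin_cases a <;> fin_cases b <;> simp <;> omega

theorem coeff_polyInc_eq_zero {k : ℕ} {A : PMat} (hA : A ∈ polySym k) (i j : Fin 3)
    {d : Fin 3 →₀ ℕ} (hd : k < d 0 + d 1 + d 2 + 2) : coeff d (polyInc A i j) = 0 := by
  have h (i j a b : Fin 3) := coeff_pderiv_pderiv_eq_zero (hA.1 i j) a b hd
  rw [polyInc_eq]
  fin_cases i <;> fin_cases j <;> simp [h]

theorem eq_zero_of_pderiv_eq_zero {p : MvPolynomial (Fin 3) ℝ} {i : Fin 3}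
    (hp : pderiv i p = 0) (h0 : ∀ d : Fin 3 →₀ ℕ, d i = 0 → coeff d p = 0) : p = 0 := by
  ext d
  rw [coeff_zero]
  by_cases hd : d i = 0
  · exact h0 d hd
  · have := coeff_pderiv (i := i) p (d - Finsupp.single i 1)
    rw [hp, coeff_zero, Finsupp.sub_add_single_one_cancel hd] at this
    exact (mul_eq_zero.1 this.symm).resolve_right (by positivity)

/-- Index set of the coefficients that determine a divergence-free symmetric matrix of
polynomials of degree at most `k - 2`. -/
abbrev Idx (k : ℕ) : Type := Fin 3 × exps Finset.univ k ⊕ Fin 3 × exps {0, 1} k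

/-- The coefficients of the entries `00`, `01`, `11`, and those of the last column on the plane
where the last coordinate vanishes. -/
def coeffMap (k : ℕ) : PMat →ₗ[ℝ] (Idx k → ℝ) where
  toFun σ := Sum.elim (fun t => coeff t.2.1 (![σ 0 0, σ 0 1, σ 1 1] t.1))
    (fun t => coeff t.2.1 (σ t.1 2))
  map_add' σ τ := by
    ext (⟨i, d⟩ | ⟨i, d⟩)
    · fin_cases i <;> simp
    · simp
  map_smul' c σ := by
    ext (⟨i, d⟩ | ⟨i, d⟩)
    · fin_cases i <;> simp
    · simp

theorem eq_zero_of_coeffMap_eq_zero {k : ℕ} {σ : PMat}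
    (hdeg : ∀ i j (d : Fin 3 →₀ ℕ), k < d 0 + d 1 + d 2 + 2 → coeff d (σ i j) = 0)
    (hs : ∀ i j, σ i j = σ j i)
    (hdiv : ∀ i, pderiv 0 (σ i 0) + pderiv 1 (σ i 1) + pderiv 2 (σ i 2) = 0)
    (h : coeffMap k σ = 0) : σ = 0 := by
  have hfree (i : Fin 3) : ![σ 0 0, σ 0 1, σ 1 1] i = 0 := by
    ext d
    by_cases hd : d 0 + d 1 + d 2 + 2 ≤ k
    · exact congrFun h (Sum.inl (i, ⟨d, mem_exps_univ.2 hd⟩))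
    · fin_cases i <;> exact hdeg _ _ _ (not_le.1 hd)
  have hbd (i : Fin 3) (d : Fin 3 →₀ ℕ) (h2 : d 2 = 0) : coeff d (σ i 2) = 0 := by
    by_cases hd : d 0 + d 1 + d 2 + 2 ≤ k
    · exact congrFun h (Sum.inr (i, ⟨d, mem_exps_pair.2 ⟨by omega, h2⟩⟩))
    · exact hdeg _ _ _ (not_le.1 hd)
  have h00 : σ 0 0 = 0 := hfree 0
  have h01 : σ 0 1 = 0 := hfree 1
  have h11 : σ 1 1 = 0 := hfree 2
  have hcol (i : Fin 3) (h0 : σ i 0 = 0) (h1 : σ i 1 = 0) : σ i 2 = 0 := by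
    refine eq_zero_of_pderiv_eq_zero ?_ (hbd i)
    simpa [h0, h1] using hdiv i
  have h10 : σ 1 0 = 0 := by rw [hs, h01]
  have h02 := hcol 0 h00 h01
  have h12 := hcol 1 h10 h11
  have h20 : σ 2 0 = 0 := by rw [hs, h02]
  have h21 : σ 2 1 = 0 := by rw [hs, h12]
  have h22 := hcol 2 h20 h21
  ext1 i j
  fin_cases i <;> fin_cases j <;> assumption

/-- The polynomial of degree at most `k` with prescribed coefficients. -/
def ofCoeff (k : ℕ) (h : (Fin 3 →₀ ℕ) → ℝ) : MvPolynomial (Fin 3) ℝ :=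
  ∑ e ∈ exps Finset.univ (k + 2), monomial e (h e)

theorem coeff_ofCoeff (k : ℕ) (h : (Fin 3 →₀ ℕ) → ℝ) (d : Fin 3 →₀ ℕ) :
    coeff d (ofCoeff k h) = if d 0 + d 1 + d 2 ≤ k then h d else 0 := by
  simp [ofCoeff, coeff_sum, coeff_monomial, mem_exps_univ]

theorem exists_coeffMap_eq (k : ℕ) (F G : Fin 3 → (Fin 3 →₀ ℕ) → ℝ) :
    ∃ A ∈ polySym k, coeffMap k (polyInc A) =
      Sum.elim (fun t => F t.1 t.2.1) (fun t => G t.1 t.2.1) := by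
  let e (i : Fin 3) : Fin 3 →₀ ℕ := Finsupp.single i 1
  let p := ofCoeff k fun d =>
    if 2 ≤ d 2 then -F 2 (d - e 2 - e 2) / (d 2 * (d 2 - 1))
    else if d 2 = 1 then G 1 (d - e 1 - e 2) / d 1 else 0
  let q := ofCoeff k fun d =>
    if 2 ≤ d 2 then F 1 (d - e 2 - e 2) / (d 2 * (d 2 - 1))
    else if d 2 = 0 then G 2 (d - e 1 - e 0) / (2 * d 0 * d 1) else 0
  let r := ofCoeff k fun d =>
    if 2 ≤ d 2 then -F 0 (d - e 2 - e 2) / (d 2 * (d 2 - 1))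
    else if d 2 = 1 then G 0 (d - e 0 - e 2) / d 0 else 0
  refine ⟨!![p, q, 0; q, r, 0; 0, 0, 0], ⟨fun i j d hd => ?_, fun i j => ?_⟩, ?_⟩
  · have h (f) : coeff d (ofCoeff k f) = 0 := by rw [coeff_ofCoeff, if_neg (not_le.2 hd)]
    fin_cases i <;> fin_cases j <;> simp [p, q, r, h]
  · fin_cases i <;> fin_cases j <;> rfl
  · rw [polyInc_eq]
    ext (⟨i, d, hd⟩ | ⟨i, d, hd⟩)
    · rw [mem_exps_univ] at hd
      have hd' : d 0 + d 1 + (d 2 + 1 + 1) ≤ k := by omega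
      have h1 : (d 2 : ℝ) + 1 ≠ 0 := by positivity
      have h2 : (d 2 : ℝ) + 1 + 1 ≠ 0 := by positivity
      fin_cases i <;> simp [coeffMap, coeff_pderiv, p, q, r, coeff_ofCoeff, hd', e] <;>
        field_simp
    · rw [mem_exps_pair] at hd
      obtain ⟨hd, h2⟩ := hd
      have h3 : (d 0 : ℝ) + 1 ≠ 0 := by positivity
      have h4 : (d 1 : ℝ) + 1 ≠ 0 := by positivity
      have ha : d 0 + 1 + d 1 + 1 ≤ k := by omega
      have hb : d 0 + (d 1 + 1) + 1 ≤ k := by omega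
      have hc : d 0 + 1 + (d 1 + 1) ≤ k := by omega
      have := pderiv_comm 1 0
      fin_cases i <;>
        simp [coeffMap, this, coeff_pderiv, p, q, r, coeff_ofCoeff, ha, hb, hc, e, h2] <;>
        field_simp
      norm_num

/-- Restriction of `coeffMap` to the image of the incompatibility operator. -/
def incEquiv (k : ℕ) : (polySym k).map polyInc ≃ₗ[ℝ] (Idx k → ℝ) :=
  LinearEquiv.ofBijective ((coeffMap k).domRestrict ((polySym k).map polyInc)) <| by
    constructor
    · rw [← LinearMap.ker_eq_bot, LinearMap.ker_eq_bot']
      rintro ⟨_, A, hA, rfl⟩ h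
      exact Subtype.ext (eq_zero_of_coeffMap_eq_zero (fun i j _ => coeff_polyInc_eq_zero hA i j)
        (polyInc_symm hA.2) (div_polyInc hA.2) h)
    · intro c
      classical
      obtain ⟨A, hA, h⟩ := exists_coeffMap_eq k
        (fun i d => if h : d ∈ exps Finset.univ k then c (Sum.inl (i, ⟨d, h⟩)) else 0)
        (fun i d => if h : d ∈ exps {0, 1} k then c (Sum.inr (i, ⟨d, h⟩)) else 0)
      refine ⟨⟨polyInc A, A, hA, rfl⟩, h.trans ?_⟩
      ext (t | t) <;> simp

/-- the image `inc P_k(ℝ³;𝕊)` has dimension `(k+4)(k²−k)/2`. -/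
theorem stmt_4 (k : ℕ) :
    Module.finrank ℝ
      (Submodule.span ℝ {f : V3 → M3 | ∃ τ : V3 → M3, PolySym k τ ∧ f = incOp τ})
      = (k + 4) * (k ^ 2 - k) / 2 := by
  rw [span_inc_eq, ← (Submodule.equivMapOfInjective evalMat evalMat_injective _).finrank_eq,
    (incEquiv k).finrank_eq, Module.finrank_pi, ← card_exps_formula]
  simp
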